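/- Let X be a Banach space over the complex field ℂ with dim X ≥ 2, let B(X) be the algebra of all bounded linear operators on X, and let n ≥ 2. Then every Lie n-derivation on B(X) is standard. -/

import Mathlib

open Finset

/-- Iterated commutator: `pCom x k = p_{k+1}(x 0, ..., x k)`, i.e.
`pCom x 0 = x 0` and `pCom x (k+1) = [pCom x k, x (k+1)]`. -/
def pCom {A : Type*} [Ring A] (x : ℕ → A) : ℕ → A
  | 0 => x 0
  | k + 1 => pCom x k * x (k + 1) - x (k + 1) * pCom x k

/-- `φ` is a Lie `n`-derivation. -/
def IsLieNDeriv {R : Type*} {A : Type*} [CommRing R] [Ring A] [Algebra R A]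
    (n : ℕ) (φ : A →ₗ[R] A) : Prop :=
  ∀ x : ℕ → A,
    φ (pCom x (n - 1)) =
      ∑ i ∈ Finset.range n, pCom (Function.update x i (φ (x i))) (n - 1)

/-- `d` is a derivation. -/
def IsDeriv {R : Type*} {A : Type*} [CommRing R] [Ring A] [Algebra R A]
    (d : A →ₗ[R] A) : Prop :=
  ∀ x y : A, d (x * y) = d x * y + x * d y

/-- `δ` is a Jordan derivation. -/
def IsJordanDeriv {R : Type*} {A : Type*} [CommRing R] [Ring A] [Algebra R A]
    (δ : A →ₗ[R] A) : Prop :=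
  ∀ x y : A, δ (x * y + y * x) = δ x * y + y * δ x + x * δ y + δ y * x

/-- `δ` is an antiderivation. -/
def IsAntiDeriv {R : Type*} {A : Type*} [CommRing R] [Ring A] [Algebra R A]
    (δ : A →ₗ[R] A) : Prop :=
  ∀ x y : A, δ (x * y) = δ y * x + y * δ x

/-- `δ` is a singular Jordan derivation relative to the idempotent `e`
(with `f = 1 - e`): it is a Jordan derivation killing `eAe` and `fAf`,
mapping `eAf` into `fAe` and `fAe` into `eAf`. -/
def IsSingularJordanDeriv {R : Type*} {A : Type*} [CommRing R] [Ring A] [Algebra R A]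
    (e : A) (δ : A →ₗ[R] A) : Prop :=
  IsJordanDeriv δ ∧
  (∀ a : A, δ (e * a * e) = 0) ∧
  (∀ b : A, δ ((1 - e) * b * (1 - e)) = 0) ∧
  (∀ m : A, δ (e * m * (1 - e)) = (1 - e) * δ (e * m * (1 - e)) * e) ∧
  (∀ t : A, δ ((1 - e) * t * e) = e * δ ((1 - e) * t * e) * (1 - e))

/-- `z` is a central element. -/
def IsCent {A : Type*} [Ring A] (z : A) : Prop := ∀ y : A, z * y = y * z

/-- The centre of `A` as a set. -/
def centerSet (A : Type*) [Ring A] : Set A := {z : A | ∀ y : A, z * y = y * z}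

/-- `γ` vanishes on all `(n-1)`-th commutators. -/
def VanishesOnNCommutators {R : Type*} {A : Type*} [CommRing R] [Ring A] [Algebra R A]
    (n : ℕ) (γ : A →ₗ[R] A) : Prop :=
  ∀ x : ℕ → A, γ (pCom x (n - 1)) = 0

/-- A Lie `n`-derivation is standard if it is the sum of a derivation and a
central-valued map vanishing on all `(n-1)`-th commutators. -/
def IsStandardLieNDeriv {R : Type*} {A : Type*} [CommRing R] [Ring A] [Algebra R A]
    (n : ℕ) (φ : A →ₗ[R] A) : Prop :=
  ∃ d γ : A →ₗ[R] A,
    IsDeriv d ∧ (∀ x : A, IsCent (γ x)) ∧ VanishesOnNCommutators n γ ∧ φ = d + γ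

/-- Property (Q) for the idempotent `e` (with `f = 1 - e`):
`exe·eAf = 0 = fAe·exe` implies `exe = 0`, and
`eAf·fxf = 0 = fxf·fAe` implies `fxf = 0`. -/
def PropQ {A : Type*} [Ring A] (e : A) : Prop :=
  (∀ x : A,
    ((∀ y : A, (e * x * e) * (e * y * (1 - e)) = 0) ∧
     (∀ y : A, ((1 - e) * y * e) * (e * x * e) = 0)) → e * x * e = 0) ∧
  (∀ x : A,
    ((∀ y : A, (e * y * (1 - e)) * ((1 - e) * x * (1 - e)) = 0) ∧
     (∀ y : A, ((1 - e) * x * (1 - e)) * ((1 - e) * y * e) = 0)) →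
        (1 - e) * x * (1 - e) = 0)

/-- `A` is `k`-torsion free. -/
def TorsionFreeAt (A : Type*) [Ring A] (k : ℕ) : Prop :=
  ∀ x : A, k • x = 0 → x = 0

/-- The centre of the corner algebra `gAg` (for an idempotent `g`). -/
def cornerCenter {A : Type*} [Ring A] (g : A) : Set A :=
  {z : A | z = g * z * g ∧ ∀ a : A, z * (g * a * g) = (g * a * g) * z}

/-- The corner algebra `gAg` has no nonzero central ideal: every
ideal of `gAg` consisting of elements central in `gAg` is zero. -/
def NoNonzeroCentralIdeal (R : Type*) [CommRing R] (A : Type*) [Ring A] [Algebra R A]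
    (g : A) : Prop :=
  ∀ I : Set A, (0 : A) ∈ I →
    (∀ x ∈ I, x = g * x * g) →
    (∀ x ∈ I, ∀ y ∈ I, x + y ∈ I) →
    (∀ r : R, ∀ x ∈ I, r • x ∈ I) →
    (∀ x ∈ I, ∀ a : A, (g * a * g) * x ∈ I) →
    (∀ x ∈ I, ∀ a : A, x * (g * a * g) ∈ I) →
    (∀ x ∈ I, ∀ a : A, x * (g * a * g) = (g * a * g) * x) →
    ∀ x ∈ I, x = 0

/-- The generating set of `S(gAg)`: all idempotents of `gAg` together with all
commutators of elements of `gAg`. -/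
def cornerGenSet {A : Type*} [Ring A] (g : A) : Set A :=
  {x : A | x = g * x * g ∧ x * x = x} ∪
  {x : A | ∃ a b : A, x = (g * a * g) * (g * b * g) - (g * b * g) * (g * a * g)}

/-- `gAg = S(gAg)`: the corner algebra is generated (as an algebra) by its
idempotents and commutators. -/
def CornerGenerated (R : Type*) [CommRing R] {A : Type*} [Ring A] [Algebra R A]
    (g : A) : Prop :=
  ∀ x : A, g * x * g ∈ NonUnitalAlgebra.adjoin R (cornerGenSet g)

/-- Condition (*) for the corner algebra `gAg`: if `[x, gAg] ⊆ Z(gAg)` then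
`x ∈ Z(gAg)`. -/
def CornerCondStar {A : Type*} [Ring A] (g : A) : Prop :=
  ∀ x : A, x = g * x * g →
    (∀ a : A, x * (g * a * g) - (g * a * g) * x ∈ cornerCenter g) →
    x ∈ cornerCenter g

/-- The formal derivative of `pCom` along `φ`: the sum of the iterated commutators in which
one entry `x i` is replaced by `φ (x i)`. -/
def pComDeriv {R A : Type*} [CommRing R] [Ring A] [Algebra R A] (φ : A →ₗ[R] A)
    (x : ℕ → A) (k : ℕ) : A :=
  ∑ i ∈ Finset.range (k + 1), pCom (Function.update x i (φ (x i))) k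

section General

variable {R A : Type*} [CommRing R] [Ring A] [Algebra R A]

theorem pCom_update_of_lt (x : ℕ → A) (y : A) {i k : ℕ} (h : k < i) :
    pCom (Function.update x i y) k = pCom x k := by
  induction k with
  | zero => simp [pCom, Function.update_of_ne h.ne]
  | succ k ih => simp [pCom, ih (by omega), Function.update_of_ne h.ne]

theorem pComDeriv_zero (φ : A →ₗ[R] A) (x : ℕ → A) : pComDeriv φ x 0 = φ (x 0) := by
  simp [pComDeriv, pCom]

theorem pComDeriv_succ (φ : A →ₗ[R] A) (x : ℕ → A) (k : ℕ) :
    pComDeriv φ x (k + 1) =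
      (pComDeriv φ x k * x (k + 1) - x (k + 1) * pComDeriv φ x k) +
        (pCom x k * φ (x (k + 1)) - φ (x (k + 1)) * pCom x k) := by
  unfold pComDeriv
  rw [Finset.sum_range_succ _ (k + 1), Finset.sum_mul, Finset.mul_sum,
    ← Finset.sum_sub_distrib]
  congr 1
  · refine Finset.sum_congr rfl fun i hi => ?_
    have : k + 1 ≠ i := by have := Finset.mem_range.1 hi; omega
    simp [pCom, Function.update_of_ne this]
  · simp [pCom, pCom_update_of_lt x _ (Nat.lt_succ_self k)]

theorem isLieNDeriv_succ_iff (φ : A →ₗ[R] A) (k : ℕ) :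
    IsLieNDeriv (k + 1) φ ↔ ∀ x : ℕ → A, φ (pCom x k) = pComDeriv φ x k :=
  Iff.rfl

theorem IsDeriv.map_pCom {d : A →ₗ[R] A} (hd : IsDeriv d) (x : ℕ → A) (k : ℕ) :
    d (pCom x k) = pComDeriv d x k := by
  induction k with
  | zero => simp [pCom, pComDeriv_zero]
  | succ k ih =>
    rw [pComDeriv_succ, ← ih, pCom, map_sub, hd, hd]
    abel

theorem pComDeriv_sub (φ ψ : A →ₗ[R] A) (x : ℕ → A) (k : ℕ) :
    pComDeriv (φ - ψ) x k = pComDeriv φ x k - pComDeriv ψ x k := by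
  induction k with
  | zero => simp [pComDeriv_zero]
  | succ k ih =>
    simp only [pComDeriv_succ, ih, LinearMap.sub_apply]
    noncomm_ring

theorem IsLieNDeriv.sub_isDeriv {φ d : A →ₗ[R] A} {k : ℕ} (hφ : IsLieNDeriv (k + 1) φ)
    (hd : IsDeriv d) : IsLieNDeriv (k + 1) (φ - d) := by
  rw [isLieNDeriv_succ_iff] at *
  intro x
  rw [pComDeriv_sub, LinearMap.sub_apply, hφ, hd.map_pCom]

theorem IsLieNDeriv.two_to_three {φ : A →ₗ[R] A} (hφ : IsLieNDeriv 2 φ) :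
    IsLieNDeriv 3 φ := by
  have h2 : ∀ a b : A, φ (a * b - b * a) = (φ a * b - b * φ a) + (a * φ b - φ b * a) := by
    intro a b
    have := (isLieNDeriv_succ_iff φ 1).1 hφ (fun i => if i = 0 then a else b)
    simpa [pComDeriv_succ, pComDeriv_zero, pCom] using this
  refine (isLieNDeriv_succ_iff φ 2).2 fun x => ?_
  simp only [pComDeriv_succ, pComDeriv_zero, pCom, h2]

/-- A centre-valued Lie `n`-derivation vanishes on `(n-1)`-th commutators. -/
theorem IsLieNDeriv.vanishes_of_isCent {γ : A →ₗ[R] A} {k : ℕ}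
    (hγ : IsLieNDeriv (k + 2) γ) (hc : ∀ x, IsCent (γ x)) :
    VanishesOnNCommutators (k + 2) γ := by
  have key : ∀ (x : ℕ → A) (j : ℕ), IsCent (pComDeriv γ x j) → pComDeriv γ x (j + 1) = 0 := by
    intro x j hj
    rw [pComDeriv_succ, hj, hc]
    simp
  intro x
  have h := (isLieNDeriv_succ_iff γ (k + 1)).1 hγ x
  refine h.trans (key x k ?_)
  induction k with
  | zero => rw [pComDeriv_zero]; exact hc _
  | succ k _ =>
    have hz : ∀ j, IsCent (pComDeriv γ x j) := by
      intro j
      induction j with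
      | zero => rw [pComDeriv_zero]; exact hc _
      | succ j ih => rw [key x j ih]; intro y; simp
    exact hz _

theorem isDeriv_commutator (b : A) :
    IsDeriv (LinearMap.mulRight R b - LinearMap.mulLeft R b) := by
  intro x y
  simp only [LinearMap.sub_apply, LinearMap.mulRight_apply, LinearMap.mulLeft_apply]
  noncomm_ring

end General

section MinimalIdempotent

variable {K A : Type*} [Field K] [Ring A] [Algebra K A]

/-- The map `x ↦ [x, e]`. -/
def commRight (K : Type*) {A : Type*} [Field K] [Ring A] [Algebra K A] (e : A) :
    A →ₗ[K] A :=
  LinearMap.mulRight K e - LinearMap.mulLeft K e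

theorem commRight_apply (e x : A) : commRight K e x = x * e - e * x := rfl

theorem commRight_pow_succ_apply (e x : A) (i : ℕ) :
    (commRight K e ^ (i + 1)) x =
      (commRight K e ^ i) x * e - e * (commRight K e ^ i) x := by
  rw [pow_succ', Module.End.mul_apply, commRight_apply]

theorem commRight_sq_apply (e x : A) :
    (commRight K e ^ 2) x = (x * e - e * x) * e - e * (x * e - e * x) := by
  rw [pow_two, Module.End.mul_apply, commRight_apply, commRight_apply]

theorem commRight_pow_three {e : A} (he : e * e = e) : commRight K e ^ 3 = commRight K e := by
  ext x
  rw [pow_succ', Module.End.mul_apply, commRight_sq_apply, commRight_apply, commRight_apply]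
  have h : ∀ y, e * (e * y) = e * y := fun y => by rw [← mul_assoc, he]
  simp only [mul_sub, sub_mul, mul_assoc, he, h]
  abel

theorem commRight_pow_even {e : A} (he : e * e = e) (j : ℕ) :
    commRight K e ^ (2 * j + 2) = commRight K e ^ 2 := by
  induction j with
  | zero => rfl
  | succ j ih =>
    rw [show 2 * (j + 1) + 2 = (2 * j + 2) + 2 by ring, pow_add, ih, ← pow_add,
      show 2 + 2 = 3 + 1 by rfl, pow_succ, commRight_pow_three he, pow_two]

theorem commRight_pow_add_apply (e x : A) (i j : ℕ) :
    (commRight K e ^ i) ((commRight K e ^ j) x) = (commRight K e ^ (i + j)) x := by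
  rw [pow_add, Module.End.mul_apply]

theorem pCom_of_tail {e : A} {x : ℕ → A} {j : ℕ} (hx : ∀ i, j < i → x i = e) (i : ℕ) :
    pCom x (j + i) = (commRight K e ^ i) (pCom x j) := by
  induction i with
  | zero => rfl
  | succ i ih =>
    rw [commRight_pow_succ_apply, ← ih, ← hx (j + i + 1) (by omega)]
    rfl

theorem pComDeriv_of_tail {φ : A →ₗ[K] A} {e : A} (hc : IsCent (φ e)) {x : ℕ → A} {j : ℕ}
    (hx : ∀ i, j < i → x i = e) (i : ℕ) :
    pComDeriv φ x (j + i) = (commRight K e ^ i) (pComDeriv φ x j) := by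
  induction i with
  | zero => rfl
  | succ i ih =>
    rw [commRight_pow_succ_apply, ← ih, ← add_assoc, pComDeriv_succ, hx (j + i + 1) (by omega),
      hc, sub_self, add_zero]

theorem IsLieNDeriv.map_commRight_pow {φ : A →ₗ[K] A} {e : A} {k : ℕ}
    (hφ : IsLieNDeriv (k + 1) φ) (hc : IsCent (φ e)) (x : A) :
    φ ((commRight K e ^ k) x) = (commRight K e ^ k) (φ x) := by
  have hx : ∀ i, 0 < i → (fun i => if i = 0 then x else e : ℕ → A) i = e :=
    fun i hi => by simp [hi.ne']
  have := (isLieNDeriv_succ_iff φ k).1 hφ (fun i => if i = 0 then x else e)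
  rw [← zero_add k, pCom_of_tail (K := K) hx, pComDeriv_of_tail hc hx] at this
  simpa [pComDeriv_zero, pCom] using this

theorem IsLieNDeriv.map_commRight_sq {φ : A →ₗ[K] A} {e : A} {k : ℕ} (he : e * e = e)
    (hφ : IsLieNDeriv (k + 2) φ) (hc : IsCent (φ e)) (x : A) :
    φ ((commRight K e ^ 2) x) = (commRight K e ^ 2) (φ x) := by
  have h := hφ.map_commRight_pow hc ((commRight K e ^ (k + 1)) x)
  rwa [hφ.map_commRight_pow hc x, commRight_pow_add_apply, commRight_pow_add_apply,
    show k + 1 + (k + 1) = 2 * k + 2 by ring, commRight_pow_even he] at h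

/-- Up to the projection `[[·, e], e]`, a Lie `n`-derivation whose value at the idempotent `e`
is central behaves like a Lie triple derivation. -/
theorem IsLieNDeriv.map_triple {φ : A →ₗ[K] A} {e : A} {k : ℕ} (he : e * e = e)
    (hφ : IsLieNDeriv (k + 3) φ) (hc : IsCent (φ e)) (x y z : A) :
    φ ((commRight K e ^ 2) ((x * y - y * x) * z - z * (x * y - y * x))) =
      (commRight K e ^ 2)
        (((φ x * y - y * φ x) * z - z * (φ x * y - y * φ x)) +
        ((x * φ y - φ y * x) * z - z * (x * φ y - φ y * x)) +
        ((x * y - y * x) * φ z - φ z * (x * y - y * x))) := by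
  set q : ℕ → A := fun i => if i = 0 then x else if i = 1 then y else if i = 2 then z else e
    with hq
  have hx : ∀ i, 2 < i → q i = e := fun i hi => by
    simp [hq, show i ≠ 0 by omega, show i ≠ 1 by omega, show i ≠ 2 by omega]
  have h := (isLieNDeriv_succ_iff φ (k + 2)).1 hφ q
  rw [add_comm k 2, pCom_of_tail (K := K) hx, pComDeriv_of_tail hc hx] at h
  have h2 := hφ.map_commRight_pow hc ((commRight K e ^ k) (pCom q 2))
  rw [h, commRight_pow_add_apply, commRight_pow_add_apply,
    show k + 2 + k = 2 * k + 2 by ring, commRight_pow_even he] at h2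
  simpa [pCom, pComDeriv_succ, pComDeriv_zero, hq, sub_mul, mul_sub, add_mul, mul_add,
    sub_add_sub_comm] using h2

/-- `e` is a nonzero idempotent of a prime algebra `A` whose corner `e A e` is spanned by `e`,
with coordinate functional `l`. -/
structure IsMinimalIdempotent (e : A) (l : A →ₗ[K] K) : Prop where
  idem : e * e = e
  ne_zero : e ≠ 0
  corner : ∀ x, e * x * e = l x • e
  prime : ∀ a b : A, (∀ x, a * x * b = 0) → a = 0 ∨ b = 0

theorem mul_eq_zero_of_mul_eq_zero_of_mul_eq {e a b : A} (ha : a * e = 0) (hb : e * b = b) :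
    a * b = 0 := by
  rw [← hb, ← mul_assoc, ha, zero_mul]

theorem mul_eq_zero_of_mul_eq_of_mul_eq_zero {e a b : A} (ha : a * e = a) (hb : e * b = 0) :
    a * b = 0 := by
  rw [← ha, mul_assoc, hb, mul_zero]

/-- Reassociated form of an equation between products. -/
theorem mul_mul_eq_of_mul_eq {a b c : A} (h : a * b = c) (x : A) : a * (b * x) = c * x := by
  rw [← mul_assoc, h]

theorem pCom_of_idem_mul {e m : A} (hem : e * m = m) (hme : m * e = 0) (k : ℕ) :
    pCom (fun i => if i = 0 then m else e) k = (-1 : K) ^ k • m := by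
  induction k with
  | zero => simp [pCom]
  | succ k ih => simp [pCom, ih, hem, hme, pow_succ]

theorem corner_pComDeriv {φ : A →ₗ[K] A} {e m : A} (he : e * e = e)
    (hc : φ e * e = e * φ e) (hem : e * m = m) (hme : m * e = 0) (k : ℕ) :
    e * pComDeriv φ (fun i => if i = 0 then m else e) k * (1 - e) =
      (-1 : K) ^ k • (e * φ m * (1 - e) - (k : K) • (m * φ e - φ e * m)) := by
  set x : ℕ → A := fun i => if i = 0 then m else e with hx
  have hp : ∀ k, pCom x k = (-1 : K) ^ k • m := pCom_of_idem_mul hem hme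
  have h1 : ∀ y, e * (y * e - e * y) * (1 - e) = -(e * y * (1 - e)) := by
    intro y
    simp only [mul_sub, sub_mul, mul_one, mul_assoc, he, mul_mul_eq_of_mul_eq he]
    abel
  have h2 : e * (m * φ e - φ e * m) * (1 - e) = m * φ e - φ e * m := by
    have h3 : e * (m * φ e - φ e * m) = m * φ e - φ e * m := by
      rw [mul_sub, ← mul_assoc, ← mul_assoc, hem, ← hc, mul_assoc, hem]
    have h4 : (m * φ e - φ e * m) * e = 0 := by
      rw [sub_mul, mul_assoc, mul_assoc, hc, hme, ← mul_assoc, hme, zero_mul, mul_zero, sub_zero]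
    rw [h3, mul_sub, h4, mul_one, sub_zero]
  induction k with
  | zero => simp [pComDeriv_zero, hx]
  | succ k ih =>
    have hxk : x (k + 1) = e := by simp [hx]
    rw [pComDeriv_succ, hp, hxk, mul_add, add_mul, h1, ih, smul_mul_assoc, mul_smul_comm,
      ← smul_sub, mul_smul_comm, smul_mul_assoc, h2, pow_succ]
    push_cast
    module

namespace IsMinimalIdempotent

variable {e : A} {l : A →ₗ[K] K}

theorem exists_mul_eq_right (h : IsMinimalIdempotent e l) {m : A} (hm : m ≠ 0)
    (hem : e * m = m) (hme : m * e = 0) : ∃ t, e * t = 0 ∧ t * e = t ∧ m * t = e := by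
  obtain ⟨x, hx⟩ : ∃ x, m * x * e ≠ 0 := by
    by_contra! hx
    exact (h.prime m e hx).elim hm h.ne_zero
  have hl : m * x * e = l (m * x) • e := by rw [← h.corner, ← mul_assoc e, hem]
  have hne : l (m * x) ≠ 0 := fun h0 => hx (by rw [hl, h0, zero_smul])
  refine ⟨(l (m * x))⁻¹ • (x * e - e * x * e), ?_, ?_, ?_⟩
  · simp [mul_sub, mul_assoc, mul_mul_eq_of_mul_eq h.idem]
  · simp [sub_mul, mul_assoc, h.idem]
  · simp [mul_sub, ← mul_assoc, hme, hl, hne]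

theorem exists_mul_eq_left (h : IsMinimalIdempotent e l) {t : A} (ht : t ≠ 0)
    (het : e * t = 0) (hte : t * e = t) : ∃ m, e * m = m ∧ m * e = 0 ∧ m * t = e := by
  obtain ⟨x, hx⟩ : ∃ x, e * x * t ≠ 0 := by
    by_contra! hx
    exact (h.prime e t hx).elim h.ne_zero ht
  have hl : e * x * t = l (x * t) • e := by rw [← h.corner, ← mul_assoc, mul_assoc _ t, hte]
  have hne : l (x * t) ≠ 0 := fun h0 => hx (by rw [hl, h0, zero_smul])
  refine ⟨(l (x * t))⁻¹ • (e * x - e * x * e), ?_, ?_, ?_⟩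
  · simp [mul_sub, ← mul_assoc, h.idem]
  · simp [sub_mul, mul_assoc, h.idem]
  · simp [sub_mul, mul_assoc, het]
    rw [← mul_assoc, hl, smul_smul, inv_mul_cancel₀ hne, one_smul]

theorem map_idem_eq_smul_one [CharZero K] (h : IsMinimalIdempotent e l) {φ : A →ₗ[K] A} {k : ℕ}
    (hφ : IsLieNDeriv (k + 2) φ) (hc : φ e * e = e * φ e) :
    φ e = l (φ e) • (1 : A) := by
  have hm : ∀ m, e * m = m → m * e = 0 → m * φ e - φ e * m = 0 := by
    intro m hem hme
    have h1 := corner_pComDeriv h.idem hc hem hme (k + 1)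
    rw [← (isLieNDeriv_succ_iff φ (k + 1)).1 hφ] at h1
    rw [pCom_of_idem_mul (K := K) hem hme, map_smul, mul_smul_comm, smul_mul_assoc] at h1
    have h2 := smul_right_injective A (pow_ne_zero (k + 1) (neg_ne_zero.2 (one_ne_zero' K))) h1
    have h3 : ((k + 1 : ℕ) : K) • (m * φ e - φ e * m) = 0 :=
      sub_eq_self.1 h2.symm
    exact (smul_eq_zero.1 h3).resolve_left (Nat.cast_ne_zero.2 (Nat.succ_ne_zero k))
  have hec : e * φ e = l (φ e) • e := by rw [← h.corner, mul_assoc, hc, mul_mul_eq_of_mul_eq h.idem]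
  have hz : ∀ x, e * x * ((1 - e) * (φ e - l (φ e) • 1)) = 0 := by
    intro x
    have := hm (e * x * (1 - e)) (by simp [← mul_assoc, h.idem])
      (by simp [mul_assoc, sub_mul, h.idem])
    rw [← mul_assoc (φ e), ← mul_assoc (φ e), hc, hec] at this
    rw [← this]
    simp [mul_sub, sub_mul, mul_assoc, smul_sub]
  have h0 := (h.prime _ _ hz).resolve_left h.ne_zero
  rw [← sub_eq_zero, ← h0, sub_mul, one_mul, mul_sub e, hec]
  simp

variable {φ : A →ₗ[K] A} {k : ℕ}

theorem commRight_sq_mul_idem (h : IsMinimalIdempotent e l) (x : A) :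
    (commRight K e ^ 2) x * e = x * e - e * x * e := by
  rw [commRight_sq_apply]
  simp only [mul_sub, sub_mul, mul_assoc, h.idem, mul_mul_eq_of_mul_eq h.idem]
  abel

theorem idem_mul_commRight_sq (h : IsMinimalIdempotent e l) (x : A) :
    e * (commRight K e ^ 2) x = e * x - e * x * e := by
  rw [commRight_sq_apply]
  simp only [mul_sub, mul_assoc, h.idem, sub_mul, mul_mul_eq_of_mul_eq h.idem]
  abel

/-- `φ` preserves the diagonal `e A e + (1 - e) A (1 - e)`. -/
theorem map_diagonal (h : IsMinimalIdempotent e l) (hφ : IsLieNDeriv (k + 3) φ)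
    (hc : IsCent (φ e)) {a : A} (ha : a * e = e * a) :
    φ a * e = e * φ a * e ∧ e * φ a = e * φ a * e := by
  have h1 := hφ.map_commRight_sq h.idem hc a
  rw [commRight_sq_apply, ha] at h1
  simp only [sub_self, zero_mul, mul_zero, map_zero] at h1
  have h2 := h.commRight_sq_mul_idem (φ a)
  have h3 := h.idem_mul_commRight_sq (φ a)
  rw [← h1] at h2 h3
  simp only [zero_mul, mul_zero] at h2 h3
  exact ⟨sub_eq_zero.1 h2.symm, sub_eq_zero.1 h3.symm⟩

theorem idem_mul_mul_idem_eq_zero (h : IsMinimalIdempotent e l) {u : A}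
    (hu : u = e * u + u * e) : e * u * e = 0 := by
  have := congrArg (fun y => e * y) hu
  simpa [mul_add, ← mul_assoc, h.idem] using this

/-- `φ` preserves the off-diagonal part of `A`. -/
theorem map_offDiagonal (h : IsMinimalIdempotent e l) (hφ : IsLieNDeriv (k + 3) φ)
    (hc : IsCent (φ e)) {a : A} (ha : a = e * a + a * e) :
    φ a = e * φ a + φ a * e := by
  have h0 := h.idem_mul_mul_idem_eq_zero ha
  have hP : (commRight K e ^ 2) a = a := by
    rw [commRight_sq_apply]
    nth_rw 5 [ha]
    simp only [mul_sub, sub_mul, ← mul_assoc, h.idem, h0]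
    simp [mul_assoc, h.idem, add_comm]
  have h1 := hφ.map_commRight_sq h.idem hc a
  rw [hP] at h1
  have h2 := h.commRight_sq_mul_idem (φ a)
  have h3 := h.idem_mul_commRight_sq (φ a)
  rw [← h1] at h2 h3
  have h4 : e * φ a * e = 0 := sub_eq_self.1 h2.symm
  rw [commRight_sq_apply] at h1
  conv_lhs => rw [h1]
  simp only [mul_sub, sub_mul, ← mul_assoc, h.idem, h4]
  simp [mul_assoc, h.idem, add_comm]

theorem exists_upper_add_lower (h : IsMinimalIdempotent e l) {u : A}
    (hu : u = e * u + u * e) :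
    ∃ p s : A, u = p + s ∧ (e * p = p ∧ p * e = 0) ∧ (e * s = 0 ∧ s * e = s) :=
  ⟨e * u, u * e, hu,
    ⟨by rw [← mul_assoc, h.idem], h.idem_mul_mul_idem_eq_zero hu⟩,
    ⟨by rw [← mul_assoc, h.idem_mul_mul_idem_eq_zero hu], by rw [mul_assoc, h.idem]⟩⟩

theorem commRight_sq_upper {m : A} (hem : e * m = m) (hme : m * e = 0) :
    (commRight K e ^ 2) m = m := by
  simp [commRight_sq_apply, hem, hme]

theorem commRight_sq_lower {t : A} (het : e * t = 0) (hte : t * e = t) :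
    (commRight K e ^ 2) t = t := by
  simp [commRight_sq_apply, het, hte]

theorem map_upper [CharZero K] (h : IsMinimalIdempotent e l) (hφ : IsLieNDeriv (k + 3) φ)
    (hc : IsCent (φ e)) {m : A} (hem : e * m = m) (hme : m * e = 0) :
    e * φ m = φ m ∧ φ m * e = 0 := by
  rcases eq_or_ne m 0 with rfl | hm
  · simp
  obtain ⟨t, het, hte, hmt⟩ := h.exists_mul_eq_right hm hem hme
  obtain ⟨p, s, hu, ⟨hep, hpe⟩, hes, hse⟩ :=
    h.exists_upper_add_lower (h.map_offDiagonal hφ hc (a := m) (by rw [hem, hme, add_zero]))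
  obtain ⟨q, r, hv, ⟨heq, hqe⟩, her, hre⟩ :=
    h.exists_upper_add_lower (h.map_offDiagonal hφ hc (a := t) (by rw [het, hte, zero_add]))
  have hmm := mul_eq_zero_of_mul_eq_zero_of_mul_eq hme hem
  have hmq := mul_eq_zero_of_mul_eq_zero_of_mul_eq hme heq
  have hqm := mul_eq_zero_of_mul_eq_zero_of_mul_eq hqe hem
  have hmp := mul_eq_zero_of_mul_eq_zero_of_mul_eq hme hep
  have hpm := mul_eq_zero_of_mul_eq_zero_of_mul_eq hpe hem
  have hts := mul_eq_zero_of_mul_eq_of_mul_eq_zero hte hes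
  have hst := mul_eq_zero_of_mul_eq_of_mul_eq_zero hse het
  have key := hφ.map_triple h.idem hc m t m
  have hw : (m * t - t * m) * m - m * (m * t - t * m) = (2 : K) • m := by
    simp [mul_sub, sub_mul, mul_assoc, hmm, hmt, mul_mul_eq_of_mul_eq hmt, hem, hme, two_smul]
  rw [hw, map_smul, map_smul, commRight_sq_upper hem hme, hu, hv] at key
  have key2 := congrArg (fun y => y * e) key
  simp only [h.commRight_sq_mul_idem] at key2
  simp [mul_sub, sub_mul, mul_add, add_mul, mul_assoc, hmm, hmt, hmq, hqm,
    hmp, hpm, hts, hst, hem, hme, het, hte, hep, hpe, hes, hse, mul_mul_eq_of_mul_eq hmt,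
    mul_mul_eq_of_mul_eq hmq, mul_mul_eq_of_mul_eq hpm, mul_mul_eq_of_mul_eq hem,
    mul_mul_eq_of_mul_eq het,
    mul_mul_eq_of_mul_eq hst, mul_mul_eq_of_mul_eq hmp] at key2
  have hms : (4 : K) • (m * s) = 0 := by
    have := congrArg (fun y => m * y) key2
    simp only [mul_smul_comm, mul_sub, mul_neg, mul_mul_eq_of_mul_eq hmt,
      mul_mul_eq_of_mul_eq hem] at this
    linear_combination (norm := module) this
  have hms' : m * s = 0 := (smul_eq_zero.1 hms).resolve_left (by norm_num)
  have hs : (3 : K) • s = 0 := by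
    rw [hms', mul_zero] at key2
    linear_combination (norm := module) key2
  have hs' : s = 0 := (smul_eq_zero.1 hs).resolve_left (by norm_num)
  rw [hu, hs', add_zero]
  exact ⟨hep, hpe⟩

theorem map_lower [CharZero K] (h : IsMinimalIdempotent e l) (hφ : IsLieNDeriv (k + 3) φ)
    (hc : IsCent (φ e)) {t : A} (het : e * t = 0) (hte : t * e = t) :
    e * φ t = 0 ∧ φ t * e = φ t := by
  rcases eq_or_ne t 0 with rfl | ht
  · simp
  obtain ⟨m, hem, hme, hmt⟩ := h.exists_mul_eq_left ht het hte
  obtain ⟨q, hq, ⟨heq, hqe⟩⟩ : ∃ q, φ m = q ∧ (e * q = q ∧ q * e = 0) :=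
    ⟨_, rfl, h.map_upper hφ hc hem hme⟩
  obtain ⟨p, s, hv, ⟨hep, hpe⟩, hes, hse⟩ :=
    h.exists_upper_add_lower (h.map_offDiagonal hφ hc (a := t) (by rw [het, hte, zero_add]))
  have htt := mul_eq_zero_of_mul_eq_of_mul_eq_zero hte het
  have hmp := mul_eq_zero_of_mul_eq_zero_of_mul_eq hme hep
  have hpm := mul_eq_zero_of_mul_eq_zero_of_mul_eq hpe hem
  have hts := mul_eq_zero_of_mul_eq_of_mul_eq_zero hte hes
  have hst := mul_eq_zero_of_mul_eq_of_mul_eq_zero hse het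
  have key := hφ.map_triple h.idem hc t m t
  have hw : (t * m - m * t) * t - t * (t * m - m * t) = (2 : K) • t := by
    simp [mul_sub, sub_mul, mul_assoc, htt, hmt, mul_mul_eq_of_mul_eq htt, het, hte, two_smul]
  rw [hw, map_smul, map_smul, commRight_sq_lower het hte, hv, hq] at key
  have key2 := congrArg (fun y => e * y) key
  simp only [h.idem_mul_commRight_sq] at key2
  simp [mul_sub, sub_mul, mul_add, add_mul, mul_assoc, hmt, hmp, hpm, hts, hst, hem, hme, het,
    hte, hep, hpe, hes, hse, mul_mul_eq_of_mul_eq hmt, mul_mul_eq_of_mul_eq hpm,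
    mul_mul_eq_of_mul_eq hem, mul_mul_eq_of_mul_eq het, mul_mul_eq_of_mul_eq hst,
    mul_mul_eq_of_mul_eq hmp, mul_mul_eq_of_mul_eq heq, mul_mul_eq_of_mul_eq hep] at key2
  have hpt : (4 : K) • (p * t) = 0 := by
    have := congrArg (fun y => y * t) key2
    simp only [smul_mul_assoc, sub_mul, neg_mul, mul_assoc, hmt, hte] at this
    linear_combination (norm := module) this
  have hpt' : p * t = 0 := (smul_eq_zero.1 hpt).resolve_left (by norm_num)
  have hp : (3 : K) • p = 0 := by
    rw [mul_mul_eq_of_mul_eq hpt', zero_mul] at key2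
    linear_combination (norm := module) key2
  have hp' : p = 0 := (smul_eq_zero.1 hp).resolve_left (by norm_num)
  rw [hv, hp', zero_add]
  exact ⟨hes, hse⟩

/-- The Leibniz rule for `φ` on products in `e A (1 - e) · (1 - e) A e`. -/
theorem map_mul_add_mul_map [CharZero K] (h : IsMinimalIdempotent e l)
    (hφ : IsLieNDeriv (k + 3) φ) (hc : IsCent (φ e)) {m t : A} (hem : e * m = m)
    (hme : m * e = 0) (het : e * t = 0) (hte : t * e = t) :
    φ m * t + m * φ t = 0 := by
  rcases eq_or_ne m 0 with rfl | hm
  · simp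
  have hmt : m * t = l (m * t) • e := by
    rw [← h.corner, mul_assoc, mul_assoc, hte, ← mul_assoc, hem]
  set α := l (m * t)
  obtain ⟨q, hq, ⟨heq, hqe⟩⟩ : ∃ q, φ m = q ∧ (e * q = q ∧ q * e = 0) :=
    ⟨_, rfl, h.map_upper hφ hc hem hme⟩
  obtain ⟨s, hs, ⟨hes, hse⟩⟩ : ∃ s, φ t = s ∧ (e * s = 0 ∧ s * e = s) :=
    ⟨_, rfl, h.map_lower hφ hc het hte⟩
  have hmm := mul_eq_zero_of_mul_eq_zero_of_mul_eq hme hem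
  have hmq := mul_eq_zero_of_mul_eq_zero_of_mul_eq hme heq
  have hqm := mul_eq_zero_of_mul_eq_zero_of_mul_eq hqe hem
  have key := hφ.map_triple h.idem hc m t m
  have hw : (m * t - t * m) * m - m * (m * t - t * m) = (2 * α) • m := by
    simp [mul_sub, sub_mul, mul_assoc, hmm, hmt, mul_mul_eq_of_mul_eq hmt, hem, hme, two_smul,
      mul_smul, smul_add]
  have hβ : q * t + m * s = l (q * t + m * s) • e := by
    rw [← h.corner, mul_add, add_mul, mul_assoc, mul_assoc, mul_assoc, mul_assoc, hte, hse,
      ← mul_assoc, ← mul_assoc, hem, heq]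
  set β := l (q * t + m * s)
  rw [hw, map_smul, map_smul, commRight_sq_upper hem hme, hq, hs] at key
  have key2 := congrArg (fun y => e * y) key
  simp only [h.idem_mul_commRight_sq] at key2
  simp [mul_sub, sub_mul, mul_add, add_mul, mul_assoc, hmm, hmt, hmq, hqm, hem, hme, heq, hqe,
    mul_mul_eq_of_mul_eq hmt, mul_mul_eq_of_mul_eq hmq, mul_mul_eq_of_mul_eq hqm,
    mul_mul_eq_of_mul_eq hem, mul_mul_eq_of_mul_eq heq, mul_mul_eq_of_mul_eq hmm] at key2
  have h1 : (q * t + m * s) * m = 0 := by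
    have h2 : (2 : K) • ((q * t + m * s) * m) = 0 := by
      rw [add_mul, mul_assoc, mul_assoc]
      linear_combination (norm := module) -key2
    exact (smul_eq_zero.1 h2).resolve_left two_ne_zero
  rw [hβ, smul_mul_assoc, hem] at h1
  rw [hq, hs, hβ, (smul_eq_zero.1 h1).resolve_right hm, zero_smul]

/-- The Leibniz rule, corrected by the scalar part of `φ`, on products in
`(1 - e) A (1 - e) · (1 - e) A e`. -/
theorem map_corner_mul_lower [CharZero K] (h : IsMinimalIdempotent e l)
    (hφ : IsLieNDeriv (k + 3) φ) (hc : IsCent (φ e)) {a t : A} (hea : e * a = 0)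
    (hae : a * e = 0) (het : e * t = 0) (hte : t * e = t) :
    φ (a * t) = φ a * t + a * φ t - l (φ a) • t := by
  obtain ⟨s, hs, ⟨hes, hse⟩⟩ : ∃ s, φ t = s ∧ (e * s = 0 ∧ s * e = s) :=
    ⟨_, rfl, h.map_lower hφ hc het hte⟩
  obtain ⟨h1, h2⟩ := h.map_diagonal hφ hc (hae.trans hea.symm)
  rw [h.corner] at h1 h2
  have hta := mul_eq_zero_of_mul_eq_of_mul_eq_zero hte hea
  have hsa := mul_eq_zero_of_mul_eq_of_mul_eq_zero hse hea
  have key := hφ.map_triple h.idem hc a t e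
  have hw : (a * t - t * a) * e - e * (a * t - t * a) = a * t := by
    simp [sub_mul, mul_sub, mul_assoc, hta, hte, hae, mul_mul_eq_of_mul_eq hea]
  have htφ : t * φ a = l (φ a) • t := by
    conv_lhs => rw [← hte, mul_assoc, h2, mul_smul_comm, hte]
  have hat : (a * t) * e = a * t := by rw [mul_assoc, hte]
  have heat : e * (a * t) = 0 := by rw [← mul_assoc, hea, zero_mul]
  rw [hw, commRight_sq_lower heat hat, hs, ← hc, sub_self, add_zero] at key
  have key2 := congrArg (fun y => y * e) key
  simp only [h.commRight_sq_mul_idem, (h.map_lower hφ hc heat hat).2] at key2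
  rw [hs, key2, htφ]
  simp [sub_mul, mul_sub, mul_add, add_mul, mul_assoc, hte, hse, hsa, hes, het, hae, h1, h2,
    mul_mul_eq_of_mul_eq hea, mul_mul_eq_of_mul_eq h2, mul_mul_eq_of_mul_eq hes,
    mul_mul_eq_of_mul_eq het]
  abel

/-- The linear map `x ↦ l (φ x) • 1`. -/
def scalarPart (l : A →ₗ[K] K) (φ : A →ₗ[K] A) : A →ₗ[K] A :=
  (l ∘ₗ φ).smulRight 1

theorem isDeriv_sub_scalarPart [CharZero K] (h : IsMinimalIdempotent e l)
    (hφ : IsLieNDeriv (k + 3) φ) (hφe : φ e = l (φ e) • (1 : A)) :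
    IsDeriv (φ - scalarPart l φ) := by
  have hc : IsCent (φ e) := by
    intro y
    rw [hφe]
    simp
  set d := φ - scalarPart l φ with hd
  have hdx : ∀ x, d x = φ x - l (φ x) • 1 := fun x => rfl
  have hl0 : ∀ u, e * u * e = 0 → l u = 0 := by
    intro u hu
    rw [h.corner] at hu
    exact (smul_eq_zero.1 hu).resolve_right h.ne_zero
  have hde : d e = 0 := by
    rw [hdx]
    nth_rw 1 [hφe]
    rw [sub_self]
  have hup : ∀ m, e * m = m → m * e = 0 → d m = φ m ∧ e * φ m = φ m ∧ φ m * e = 0 := by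
    intro m h1 h2
    have h3 := h.map_upper hφ hc h1 h2
    exact ⟨by rw [hdx, hl0 _ (by rw [mul_assoc, h3.2, mul_zero]), zero_smul, sub_zero], h3⟩
  have hlow : ∀ t, e * t = 0 → t * e = t → d t = φ t ∧ e * φ t = 0 ∧ φ t * e = φ t := by
    intro t h1 h2
    have h3 := h.map_lower hφ hc h1 h2
    exact ⟨by rw [hdx, hl0 _ (by rw [h3.1, zero_mul]), zero_smul, sub_zero], h3⟩
  have hcor : ∀ a, e * a = 0 → a * e = 0 → d a * e = 0 := by
    intro a h1 h2
    rw [hdx, sub_mul, (h.map_diagonal hφ hc (h2.trans h1.symm)).1, h.corner]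
    simp
  have hdec : ∀ x, ∃ (c : K) (m t a : A), x = c • e + m + t + a ∧
      (e * m = m ∧ m * e = 0) ∧ (e * t = 0 ∧ t * e = t) ∧ (e * a = 0 ∧ a * e = 0) := by
    intro x
    refine ⟨l x, e * x - e * x * e, x * e - e * x * e, x - e * x - x * e + e * x * e, ?_,
      ⟨?_, ?_⟩, ⟨?_, ?_⟩, ?_, ?_⟩
    · rw [← h.corner]
      abel
    all_goals
      simp [mul_sub, sub_mul, mul_add, add_mul, mul_assoc, h.idem, mul_mul_eq_of_mul_eq h.idem]
  have hxe : ∀ x, d (x * e) = d x * e := by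
    intro x
    obtain ⟨c, m, t, a, rfl, ⟨hem, hme⟩, ⟨het, hte⟩, hea, hae⟩ := hdec x
    have h1 := hup m hem hme
    have h2 := hlow t het hte
    simp [add_mul, hme, hte, hae, h.idem, hde, h1.1, h1.2.2, h2.1, h2.2.2, hcor a hea hae]
  have hxt : ∀ x t, e * t = 0 → t * e = t → d (x * t) = d x * t + x * d t := by
    intro x r her hre
    obtain ⟨c, m, t, a, rfl, ⟨hem, hme⟩, ⟨het, hte⟩, hea, hae⟩ := hdec x
    have h1 := hup m hem hme
    have h2 := hlow t het hte
    have h3 := hlow r her hre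
    have h4 : d (m * r) = 0 := by
      rw [← hem, mul_assoc, ← hre, ← mul_assoc, ← mul_assoc, mul_assoc e, h.corner, map_smul, hde,
        smul_zero]
    have h5 := h.map_mul_add_mul_map hφ hc hem hme her hre
    have h6 : d (a * r) = d a * r + a * d r := by
      rw [(hlow (a * r) (by rw [← mul_assoc, hea, zero_mul]) (by rw [mul_assoc, hre])).1,
        h.map_corner_mul_lower hφ hc hea hae her hre, h3.1, hdx, sub_mul, smul_mul_assoc, one_mul]
      abel
    have h7 : φ t * r = 0 := mul_eq_zero_of_mul_eq_of_mul_eq_zero h2.2.2 her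
    have h8 : t * φ r = 0 := mul_eq_zero_of_mul_eq_of_mul_eq_zero hte h3.2.1
    have h9 : t * r = 0 := mul_eq_zero_of_mul_eq_of_mul_eq_zero hte her
    simp only [add_mul, map_add, map_smul, smul_mul_assoc, her, hde, h4, h6, h9, h1.1, h2.1, h3.1,
      h7, h8, h3.2.1, smul_zero, zero_mul, map_zero]
    linear_combination (norm := module) -h5
  have hxw : ∀ x y, d (x * (y * e)) = d x * (y * e) + x * d (y * e) := by
    intro x y
    have h1 : y * e = l y • e + (y * e - e * y * e) := by rw [h.corner]; abel
    have h2 := hxt x (y * e - e * y * e)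
      (by simp [mul_sub, mul_assoc, mul_mul_eq_of_mul_eq h.idem])
      (by simp [sub_mul, mul_assoc, h.idem])
    rw [h1]
    simp only [mul_add, map_add, h2, mul_smul_comm, map_smul, hxe, hde, smul_zero, mul_zero]
    abel
  intro x y
  rw [← sub_eq_zero]
  refine (h.prime _ e fun z => ?_).resolve_right h.ne_zero
  have h1 := hxw (x * y) z
  rw [mul_assoc x, ← mul_assoc y, hxw x (y * z), mul_assoc y, hxw y z] at h1
  rw [mul_assoc, sub_mul, sub_eq_zero]
  simp only [mul_add, add_mul, mul_assoc] at h1 ⊢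
  rw [← add_assoc] at h1
  exact (add_right_cancel h1).symm

/-- Every Lie `n`-derivation, `n ≥ 2`, of a prime algebra over a field of characteristic zero
that has a minimal idempotent with scalar corner is standard. -/
theorem isStandardLieNDeriv [CharZero K] (h : IsMinimalIdempotent e l) {n : ℕ} (hn : 2 ≤ n)
    (hφ : IsLieNDeriv n φ) : IsStandardLieNDeriv n φ := by
  obtain ⟨j, rfl⟩ := Nat.exists_eq_add_of_le' hn
  set b := e * φ e - φ e * e with hb
  set δ : A →ₗ[K] A := LinearMap.mulRight K b - LinearMap.mulLeft K b
  have hδ : IsDeriv δ := isDeriv_commutator b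
  set ψ := φ - δ with hψ
  have hψL : IsLieNDeriv (j + 2) ψ := hφ.sub_isDeriv hδ
  have hψe : ψ e = φ e - (e * b - b * e) := rfl
  have hcomm : ψ e * e = e * ψ e := by
    rw [hψe, hb]
    simp only [mul_sub, sub_mul, mul_assoc, h.idem, mul_mul_eq_of_mul_eq h.idem]
    abel
  have hscal := h.map_idem_eq_smul_one hψL hcomm
  obtain ⟨i, hψ3⟩ : ∃ i, IsLieNDeriv (i + 3) ψ := by
    cases j with
    | zero => exact ⟨0, hψL.two_to_three⟩
    | succ j => exact ⟨j, hψL⟩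
  have hD := h.isDeriv_sub_scalarPart hψ3 hscal
  have hcent : ∀ x, IsCent (scalarPart l ψ x) := by
    intro x y
    simp [scalarPart]
  refine ⟨δ + (ψ - scalarPart l ψ), scalarPart l ψ, ?_, hcent, ?_, ?_⟩
  · intro x y
    simp only [LinearMap.add_apply, hδ x y, hD x y, add_mul, mul_add]
    abel
  · refine IsLieNDeriv.vanishes_of_isCent ?_ hcent
    have := hψL.sub_isDeriv hD
    rwa [sub_sub_cancel] at this
  · rw [hψ]
    abel

end IsMinimalIdempotent

end MinimalIdempotent

/-- A rank one projection `x ↦ g x • v`, `g v = 1`, is a minimal idempotent of the algebra of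
bounded operators. -/
theorem isMinimalIdempotent_smulRight {X : Type*} [NormedAddCommGroup X] [NormedSpace ℂ X]
    {v : X} {g : X →L[ℂ] ℂ} (hg : g v = 1) :
    IsMinimalIdempotent (g.smulRight v)
      (g.toLinearMap ∘ₗ (ContinuousLinearMap.apply ℂ X v).toLinearMap) where
  idem := by
    ext x
    simp [hg]
  ne_zero h := by
    have hv := DFunLike.congr_fun h v
    simp only [ContinuousLinearMap.smulRight_apply, hg, one_smul,
      _root_.zero_apply] at hv
    simp [hv] at hg
  corner x := by
    ext y
    simp [smul_smul, mul_comm]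
  prime a b h := by
    by_contra! hab
    obtain ⟨y, hy⟩ := DFunLike.ne_iff.1 hab.2
    obtain ⟨x, hx⟩ := DFunLike.ne_iff.1 hab.1
    obtain ⟨f, hf⟩ := SeparatingDual.exists_eq_one (R := ℂ) hy
    refine hx ?_
    simpa [hf] using DFunLike.congr_fun (h (f.smulRight x)) y

theorem stmt_19 (X : Type*) [NormedAddCommGroup X] [NormedSpace ℂ X] [CompleteSpace X]
    (hdim : 2 ≤ Module.rank ℂ X)
    (n : ℕ) (hn : 2 ≤ n)
    (φ : (X →L[ℂ] X) →ₗ[ℂ] (X →L[ℂ] X))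
    (hφ : IsLieNDeriv n φ) :
    IsStandardLieNDeriv n φ := by
  have : Nontrivial X := by
    rw [← rank_pos_iff_nontrivial (R := ℂ)]
    exact two_pos.trans_le hdim
  obtain ⟨v, hv⟩ := exists_ne (0 : X)
  obtain ⟨g, hg⟩ := SeparatingDual.exists_eq_one (R := ℂ) hv
  exact (isMinimalIdempotent_smulRight hg).isStandardLieNDeriv hn hφ
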